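/- arXiv:1602.01972 — 2 statements merged into one kernel-verified Lean document; each statement's English description precedes it below -/
import Mathlib

section
/- Let A = U − V be a proper weak regular splitting of a real m×n matrix A. If A†V ≥ 0, then A†V ≥ U†V (entrywise). -/
open Matrix

/-- `G` is the Moore-Penrose inverse of `A` (the four Penrose equations). -/
def IsMoorePenrose {m n : ℕ} (A : Matrix (Fin m) (Fin n) ℝ)
    (G : Matrix (Fin n) (Fin m) ℝ) : Prop :=
  A * G * A = A ∧ G * A * G = G ∧ (A * G)ᵀ = A * G ∧ (G * A)ᵀ = G * A

/-- `A = U - V` is a proper splitting: `range U = range A` and `null U = null A`. -/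
def IsProperSplitting {m n : ℕ} (A U V : Matrix (Fin m) (Fin n) ℝ) : Prop :=
  A = U - V ∧
    LinearMap.range U.mulVecLin = LinearMap.range A.mulVecLin ∧
    LinearMap.ker U.mulVecLin = LinearMap.ker A.mulVecLin

/-- The spectral radius of a real square matrix: the maximum modulus of its
complex eigenvalues. -/
noncomputable def specRad {k : ℕ} (X : Matrix (Fin k) (Fin k) ℝ) : ℝ :=
  (spectralRadius ℂ (X.map Complex.ofReal)).toReal

/-- Right multiplication by `G * A` fixes any matrix vanishing on the kernel of `A`. -/
lemma mul_mul_eq_of_ker_le {m n : ℕ} {A B : Matrix (Fin m) (Fin n) ℝ}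
    {G : Matrix (Fin n) (Fin m) ℝ} (hG : A * G * A = A)
    (h : LinearMap.ker A.mulVecLin ≤ LinearMap.ker B.mulVecLin) : B * G * A = B := by
  refine Matrix.ext_of_mulVec_single fun j => ?_
  have hmem : (G * A) *ᵥ Pi.single j 1 - Pi.single j 1 ∈ LinearMap.ker B.mulVecLin := by
    apply h
    rw [LinearMap.mem_ker, Matrix.mulVecLin_apply, Matrix.mulVec_sub, Matrix.mulVec_mulVec,
      ← Matrix.mul_assoc, hG, sub_self]
  rwa [LinearMap.mem_ker, Matrix.mulVecLin_apply, Matrix.mulVec_sub, Matrix.mulVec_mulVec,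
    ← Matrix.mul_assoc, sub_eq_zero] at hmem

/-- Left multiplication by `A * G` fixes any matrix whose range lies in the range of `A`. -/
lemma mul_mul_eq_of_range_le {m n : ℕ} {A B : Matrix (Fin m) (Fin n) ℝ}
    {G : Matrix (Fin n) (Fin m) ℝ} (hG : A * G * A = A)
    (h : LinearMap.range B.mulVecLin ≤ LinearMap.range A.mulVecLin) : A * G * B = B := by
  refine Matrix.ext_of_mulVec_single fun j => ?_
  obtain ⟨x, hx⟩ := h (LinearMap.mem_range_self B.mulVecLin (Pi.single j 1))
  rw [Matrix.mulVecLin_apply, Matrix.mulVecLin_apply] at hx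
  rw [← Matrix.mulVec_mulVec, ← hx, Matrix.mulVec_mulVec, hG]

/-- If the kernels of `A` and `U` agree, `U† U` is the projection `A† A`, so it fixes `A†`. -/
lemma IsMoorePenrose.mul_mul_eq_of_ker_eq {m n : ℕ} {A U : Matrix (Fin m) (Fin n) ℝ}
    {Ad Ud : Matrix (Fin n) (Fin m) ℝ} (hA : IsMoorePenrose A Ad) (hU : IsMoorePenrose U Ud)
    (h : LinearMap.ker U.mulVecLin = LinearMap.ker A.mulVecLin) : Ud * U * Ad = Ad := by
  obtain ⟨-, hA₂, -, hA₄⟩ := hA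
  obtain ⟨hU₁, -, -, hU₄⟩ := hU
  have hAU : (Ad * A) * (Ud * U) = Ad * A := by
    rw [Matrix.mul_assoc, ← Matrix.mul_assoc A, mul_mul_eq_of_ker_le hU₁ h.le]
  have hUA : (Ud * U) * (Ad * A) = Ad * A := by
    have := congrArg Matrix.transpose hAU
    rwa [Matrix.transpose_mul, hA₄, hU₄] at this
  calc Ud * U * Ad = (Ud * U) * (Ad * A) * Ad := by
        rw [Matrix.mul_assoc (Ud * U), hA₂]
    _ = Ad := by rw [hUA, hA₂]

/-- If the range of `U` lies in that of `A`, then `A A†` is absorbed by `U†`. -/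
lemma IsMoorePenrose.mul_mul_eq_of_range_le {m n : ℕ} {A U : Matrix (Fin m) (Fin n) ℝ}
    {Ad Ud : Matrix (Fin n) (Fin m) ℝ} (hA : IsMoorePenrose A Ad) (hU : IsMoorePenrose U Ud)
    (h : LinearMap.range U.mulVecLin ≤ LinearMap.range A.mulVecLin) : Ud * A * Ad = Ud := by
  obtain ⟨hA₁, -, hA₃, -⟩ := hA
  obtain ⟨-, hU₂, hU₃, -⟩ := hU
  have hAU : (A * Ad) * (U * Ud) = U * Ud := by
    rw [← Matrix.mul_assoc, _root_.mul_mul_eq_of_range_le hA₁ h]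
  have hUA : (U * Ud) * (A * Ad) = U * Ud := by
    have := congrArg Matrix.transpose hAU
    rwa [Matrix.transpose_mul, hA₃, hU₃] at this
  calc Ud * A * Ad = Ud * ((U * Ud) * (A * Ad)) := by
        rw [← Matrix.mul_assoc, ← Matrix.mul_assoc Ud U, hU₂, Matrix.mul_assoc]
    _ = Ud := by rw [hUA, ← Matrix.mul_assoc, hU₂]

theorem stmt9 {m n : ℕ} (A U V : Matrix (Fin m) (Fin n) ℝ)
    (Ad Ud : Matrix (Fin n) (Fin m) ℝ)
    (hA : IsMoorePenrose A Ad) (hU : IsMoorePenrose U Ud)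
    (hPS : IsProperSplitting A U V)
    (hUd : ∀ i j, 0 ≤ Ud i j) (hUV : ∀ i j, 0 ≤ (Ud * V) i j)
    (hAV : ∀ i j, 0 ≤ (Ad * V) i j) :
    ∀ i j, (Ud * V) i j ≤ (Ad * V) i j := by
  obtain ⟨hAUV, hrange, hker⟩ := hPS
  have hV : V = U - A := by rw [hAUV, sub_sub_cancel]
  have hdiff : Ad * V - Ud * V = (Ud * V) * (Ad * V) := by
    have : Ud * V * Ad = Ad - Ud := by
      rw [hV, Matrix.mul_sub, Matrix.sub_mul, hA.mul_mul_eq_of_ker_eq hU hker,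
        hA.mul_mul_eq_of_range_le hU hrange.le]
    rw [← Matrix.mul_assoc, this, Matrix.sub_mul]
  intro i j
  rw [← sub_nonneg, ← Matrix.sub_apply, hdiff, Matrix.mul_apply]
  exact Finset.sum_nonneg fun k _ => mul_nonneg (hUV i k) (hAV k j)
end

section
/- Let A = U − V be a proper weak regular splitting of a real m×n matrix A. If A†V ≥ U†V (entrywise), then ρ(U†V) = ρ(A†V)/(1 + ρ(A†V)) < 1. -/
open Matrix

open Filter Topology

attribute [local instance] Matrix.linftyOpNormedRing Matrix.linftyOpNormedAlgebra

theorem mem_spectrum_iff_exists_mulVec {K : Type*} [Field K] {k : ℕ}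
    {M : Matrix (Fin k) (Fin k) K} {μ : K} :
    μ ∈ spectrum K M ↔ ∃ v ≠ 0, M *ᵥ v = μ • v := by
  rw [spectrum.mem_iff, Matrix.isUnit_iff_isUnit_det, isUnit_iff_ne_zero, not_not,
    ← Matrix.exists_mulVec_eq_zero_iff]
  simp only [Matrix.sub_mulVec, sub_eq_zero, Algebra.algebraMap_eq_smul_one, Matrix.smul_mulVec,
    Matrix.one_mulVec, eq_comm]

theorem exists_norm_eq_specRad {k : ℕ} [NeZero k] (X : Matrix (Fin k) (Fin k) ℝ) :
    ∃ μ : ℂ, (∃ v ≠ 0, X.map Complex.ofReal *ᵥ v = μ • v) ∧ ‖μ‖ = specRad X := by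
  obtain ⟨μ, hμ, h⟩ := spectrum.exists_nnnorm_eq_spectralRadius (X.map Complex.ofReal)
  exact ⟨μ, mem_spectrum_iff_exists_mulVec.1 hμ, by simp [specRad, ← h]⟩

theorem norm_le_specRad {k : ℕ} {X : Matrix (Fin k) (Fin k) ℝ} {μ : ℂ} {v : Fin k → ℂ}
    (hv : v ≠ 0) (h : X.map Complex.ofReal *ᵥ v = μ • v) : ‖μ‖ ≤ specRad X := by
  have : NeZero k := ⟨by rintro rfl; exact hv (Subsingleton.elim _ _)⟩
  have hμ : μ ∈ spectrum ℂ (X.map Complex.ofReal) := mem_spectrum_iff_exists_mulVec.2 ⟨v, hv, h⟩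
  obtain ⟨ν, -, hν⟩ := spectrum.exists_nnnorm_eq_spectralRadius (X.map Complex.ofReal)
  have hle : (‖μ‖₊ : ENNReal) ≤ spectralRadius ℂ (X.map Complex.ofReal) :=
    le_iSup₂ (f := fun (z : ℂ) (_ : z ∈ spectrum ℂ (X.map Complex.ofReal)) =>
      (‖z‖₊ : ENNReal)) μ hμ
  simpa [specRad] using ENNReal.toReal_mono (by simp [← hν]) hle

theorem specRad_nonneg {k : ℕ} (X : Matrix (Fin k) (Fin k) ℝ) : 0 ≤ specRad X :=
  ENNReal.toReal_nonneg

theorem abs_le_specRad {k : ℕ} {X : Matrix (Fin k) (Fin k) ℝ} {r : ℝ} {v : Fin k → ℝ}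
    (hv : v ≠ 0) (h : X *ᵥ v = r • v) : |r| ≤ specRad X := by
  have hv' : Complex.ofReal ∘ v ≠ 0 := by
    contrapose! hv
    ext i
    simpa using congrFun hv i
  have := norm_le_specRad (X := X) (μ := r) hv' (by
    ext i
    have := congrArg Complex.ofReal (congrFun h i)
    simpa [Matrix.mulVec, dotProduct] using this)
  simpa using this

theorem specRad_smul_le {k : ℕ} [NeZero k] (X : Matrix (Fin k) (Fin k) ℝ) {c : ℝ} (hc : 0 < c) :
    specRad (c • X) ≤ c * specRad X := by
  obtain ⟨μ, ⟨v, hv, h⟩, hμ⟩ := exists_norm_eq_specRad (c • X)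
  have hc' : (c : ℂ) ≠ 0 := by exact_mod_cast hc.ne'
  have hmap : (c • X).map Complex.ofReal = (c : ℂ) • X.map Complex.ofReal := by
    ext; simp
  rw [hmap, Matrix.smul_mulVec] at h
  have := norm_le_specRad (X := X) (μ := (c : ℂ)⁻¹ * μ) hv (by
    rw [mul_smul, ← h, smul_smul, inv_mul_cancel₀ hc', one_smul])
  rw [norm_mul, norm_inv, Complex.norm_real, Real.norm_of_nonneg hc.le, hμ,
    inv_mul_le_iff₀ hc] at this
  exact this

theorem map_ofReal_pow {k : ℕ} (T : Matrix (Fin k) (Fin k) ℝ) (N : ℕ) :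
    (T ^ N).map Complex.ofReal = T.map Complex.ofReal ^ N :=
  map_pow (Complex.ofRealHom.mapMatrix) T N

/-- A nonnegative matrix `T` for which `1 - T` has a nonnegative left inverse is convergent. -/
theorem specRad_lt_one_of_nonneg_inverse {k : ℕ} [NeZero k] {T B : Matrix (Fin k) (Fin k) ℝ}
    (hT : ∀ i j, 0 ≤ T i j) (hB : ∀ i j, 0 ≤ B i j) (h : B * (1 - T) = 1) :
    specRad T < 1 := by
  have hsum (N : ℕ) : ∑ l ∈ Finset.range N, T ^ l = B - B * T ^ N := by
    rw [← one_mul (∑ l ∈ Finset.range N, T ^ l), ← h, mul_assoc, mul_neg_geom_sum, mul_sub, mul_one]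
  have hlim (i j) : Tendsto (fun N => (T ^ N) i j) atTop (𝓝 0) := by
    refine (summable_of_sum_range_le (c := B i j) (fun N => Matrix.pow_apply_nonneg hT N i j)
      fun N => ?_).tendsto_atTop_zero
    rw [← Matrix.sum_apply, hsum, Matrix.sub_apply, sub_le_self_iff, Matrix.mul_apply]
    exact Finset.sum_nonneg fun l _ => mul_nonneg (hB i l) (Matrix.pow_apply_nonneg hT N l j)
  obtain ⟨μ, ⟨v, hv, hμv⟩, hμ⟩ := exists_norm_eq_specRad T
  have hpow (N : ℕ) : (T ^ N).map Complex.ofReal *ᵥ v = μ ^ N • v := by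
    rw [map_ofReal_pow]
    induction N with
    | zero => simp
    | succ N ih => rw [pow_succ, ← Matrix.mulVec_mulVec, hμv, Matrix.mulVec_smul, ih, smul_smul,
        pow_succ, mul_comm]
  obtain ⟨i, hi⟩ := Function.ne_iff.1 hv
  have hlim' : Tendsto (fun N => μ ^ N * v i) atTop (𝓝 0) := by
    have : Tendsto (fun N => ∑ j, (((T ^ N) i j : ℝ) : ℂ) * v j) atTop
        (𝓝 (∑ j, ((0 : ℝ) : ℂ) * v j)) :=
      tendsto_finsetSum _ fun j _ =>
        ((Complex.continuous_ofReal.tendsto 0).comp (hlim i j)).mul_const _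
    simp only [Complex.ofReal_zero, zero_mul, Finset.sum_const_zero] at this
    refine this.congr fun N => ?_
    simpa [Matrix.mulVec, dotProduct] using congrFun (hpow N) i
  have hμlim : Tendsto (fun N => μ ^ N) atTop (𝓝 0) := by
    simpa [mul_assoc, mul_inv_cancel₀ (show v i ≠ 0 from hi)] using hlim'.mul_const (v i)⁻¹
  rw [← hμ]
  exact tendsto_pow_atTop_nhds_zero_iff_norm_lt_one.1 hμlim

theorem tendsto_pow_of_specRad_lt_one {k : ℕ} [NeZero k] {T : Matrix (Fin k) (Fin k) ℝ}
    (h : specRad T < 1) : Tendsto (fun N => T ^ N) atTop (𝓝 0) := by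
  have hlim : Tendsto (fun N => (T.map Complex.ofReal) ^ N) atTop (𝓝 0) := by
    obtain ⟨ν, -, hν⟩ := spectrum.exists_nnnorm_eq_spectralRadius (T.map Complex.ofReal)
    have hg := (ENNReal.tendsto_toReal (by simp [← hν])).comp
      (spectrum.pow_norm_pow_one_div_tendsto_nhds_spectralRadius (T.map Complex.ofReal))
    obtain ⟨q, hq, hq1⟩ := exists_between h
    have hq0 : 0 ≤ q := (specRad_nonneg T).trans hq.le
    refine squeeze_zero_norm' ?_ (tendsto_pow_atTop_nhds_zero_of_lt_one hq0 hq1)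
    filter_upwards [hg.eventually (gt_mem_nhds hq), eventually_ne_atTop 0] with N hN hN0
    have hr : 0 ≤ ‖T.map Complex.ofReal ^ N‖ ^ (1 / N : ℝ) := by positivity
    simp only [Function.comp_apply, ENNReal.toReal_ofReal hr] at hN
    calc ‖T.map Complex.ofReal ^ N‖ = (‖T.map Complex.ofReal ^ N‖ ^ (1 / N : ℝ)) ^ N := by
          rw [one_div, Real.rpow_inv_natCast_pow (norm_nonneg _) hN0]
      _ ≤ q ^ N := pow_le_pow_left₀ hr hN.le N
  have hre : Continuous fun M : Matrix (Fin k) (Fin k) ℂ => M.map Complex.re :=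
    continuous_id.matrix_map Complex.continuous_re
  have := (hre.tendsto 0).comp hlim
  rw [show (0 : Matrix (Fin k) (Fin k) ℂ).map Complex.re = 0 by ext; simp] at this
  refine this.congr fun N => ?_
  rw [Function.comp_apply, ← map_ofReal_pow]
  ext; simp

theorem isUnit_det_one_sub_of_specRad_lt_one {k : ℕ} {T : Matrix (Fin k) (Fin k) ℝ}
    (h : specRad T < 1) : IsUnit (1 - T).det := by
  rw [isUnit_iff_ne_zero]
  intro h0
  obtain ⟨v, hv, hTv⟩ := Matrix.exists_mulVec_eq_zero_iff.2 h0
  rw [Matrix.sub_mulVec, Matrix.one_mulVec, sub_eq_zero] at hTv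
  have := abs_le_specRad (r := 1) hv (by rw [one_smul, ← hTv])
  rw [abs_one] at this
  exact this.not_gt h

theorem inv_one_sub_nonneg {k : ℕ} [NeZero k] {T : Matrix (Fin k) (Fin k) ℝ}
    (hT : ∀ i j, 0 ≤ T i j) (h : specRad T < 1) (i j : Fin k) : 0 ≤ (1 - T)⁻¹ i j := by
  have hdet := isUnit_det_one_sub_of_specRad_lt_one h
  have hsum (N : ℕ) : ∑ l ∈ Finset.range N, T ^ l = (1 - T)⁻¹ - (1 - T)⁻¹ * T ^ N := by
    rw [← Matrix.nonsing_inv_mul_cancel_left (1 - T) (∑ l ∈ Finset.range N, T ^ l) hdet,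
      mul_neg_geom_sum, mul_sub, mul_one]
  have hlim : Tendsto (fun N => ∑ l ∈ Finset.range N, T ^ l) atTop (𝓝 (1 - T)⁻¹) := by
    simp only [hsum]
    simpa using ((tendsto_pow_of_specRad_lt_one h).const_mul (1 - T)⁻¹).const_sub (1 - T)⁻¹
  refine ge_of_tendsto' (((continuous_id.matrix_elem i j).tendsto _).comp hlim) fun N => ?_
  simp only [Function.comp_apply, id, Matrix.sum_apply]
  exact Finset.sum_nonneg fun l _ => Matrix.pow_apply_nonneg hT l i j

/-- The spectral radius of a nonnegative matrix is an eigenvalue. -/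
theorem exists_mulVec_eq_specRad_smul {k : ℕ} [NeZero k] {T : Matrix (Fin k) (Fin k) ℝ}
    (hT : ∀ i j, 0 ≤ T i j) (hpos : 0 < specRad T) :
    ∃ v ≠ 0, T *ᵥ v = specRad T • v := by
  set t := specRad T with ht
  have hdet : (1 - t⁻¹ • T).det = 0 := by
    by_contra hdet
    have hcont : ContinuousAt (fun y : ℝ => (1 - y • T)⁻¹) t⁻¹ := by
      have hlin : Continuous fun y : ℝ => 1 - y • T := by fun_prop
      refine ContinuousAt.comp (g := Inv.inv) (f := fun y : ℝ => 1 - y • T) ?_ hlin.continuousAt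
      refine continuousAt_matrix_inv _ ?_
      rw [Ring.inverse_eq_inv']
      exact continuousAt_inv₀ hdet
    have hinv (i j) : 0 ≤ (1 - t⁻¹ • T)⁻¹ i j := by
      have hlim := ((continuous_id.matrix_elem i j).tendsto _).comp
        (hcont.tendsto.mono_left (nhdsWithin_le_nhds (s := Set.Iio t⁻¹)))
      refine ge_of_tendsto hlim ?_
      filter_upwards [Ioo_mem_nhdsLT (inv_pos.2 hpos)] with y hy
      refine inv_one_sub_nonneg (fun i j => mul_nonneg hy.1.le (hT i j)) ?_ i j
      calc specRad (y • T) ≤ y * t := specRad_smul_le T hy.1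
        _ < t⁻¹ * t := by gcongr; exact hy.2
        _ = 1 := inv_mul_cancel₀ hpos.ne'
    have hlt := specRad_lt_one_of_nonneg_inverse (T := t⁻¹ • T)
      (fun i j => mul_nonneg (inv_pos.2 hpos).le (hT i j)) hinv
      (Matrix.nonsing_inv_mul _ (isUnit_iff_ne_zero.2 hdet))
    have hle := specRad_smul_le (t⁻¹ • T) hpos
    rw [smul_smul, mul_inv_cancel₀ hpos.ne', one_smul, ← ht] at hle
    nlinarith
  obtain ⟨v, hv, h⟩ := Matrix.exists_mulVec_eq_zero_iff.2 hdet
  refine ⟨v, hv, ?_⟩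
  rw [Matrix.sub_mulVec, Matrix.one_mulVec, sub_eq_zero, Matrix.smul_mulVec] at h
  conv_rhs => rw [h]
  rw [smul_smul, mul_inv_cancel₀ hpos.ne', one_smul]

theorem specRad_eq_div_one_add {k : ℕ} {T H : Matrix (Fin k) (Fin k) ℝ}
    (hT : ∀ i j, 0 ≤ T i j) (hH : ∀ i j, 0 ≤ H i j) (h : (1 - T) * (1 + H) = 1) :
    specRad T = specRad H / (1 + specRad H) ∧ specRad T < 1 := by
  rcases Nat.eq_zero_or_pos k with rfl | hk
  · have h0 (X : Matrix (Fin 0) (Fin 0) ℝ) : specRad X = 0 := by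
      simp [specRad, spectrum.SpectralRadius.of_subsingleton]
    simp [h0]
  have : NeZero k := ⟨hk.ne'⟩
  have h' : (1 + H) * (1 - T) = 1 := mul_eq_one_comm.1 h
  have hlt : specRad T < 1 := by
    refine specRad_lt_one_of_nonneg_inverse hT (fun i j => ?_) h'
    exact add_nonneg (by rw [Matrix.one_apply]; split_ifs <;> norm_num) (hH i j)
  refine ⟨?_, hlt⟩
  have hH0 := specRad_nonneg H
  have hT0 := specRad_nonneg T
  have hle : specRad H ≤ specRad T * (1 + specRad H) := by
    obtain ⟨μ, ⟨v, hv, hμv⟩, hμ⟩ := exists_norm_eq_specRad H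
    have hc : (1 - T.map Complex.ofReal) * (1 + H.map Complex.ofReal) = 1 := by
      have := congrArg Complex.ofRealHom.mapMatrix h
      rwa [map_mul, map_sub, map_add, map_one] at this
    have hv1 : (1 - T.map Complex.ofReal) *ᵥ ((1 + μ) • v) = v := by
      rw [add_smul, one_smul, ← hμv]
      nth_rw 1 [← Matrix.one_mulVec v]
      rw [← Matrix.add_mulVec, Matrix.mulVec_mulVec, hc, Matrix.one_mulVec]
    have hμ1 : 1 + μ ≠ 0 := by
      intro h0
      rw [h0, zero_smul, Matrix.mulVec_zero] at hv1
      exact hv hv1.symm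
    have hTv : T.map Complex.ofReal *ᵥ v = (μ / (1 + μ)) • v := by
      have h1 : (1 + μ) • (T.map Complex.ofReal *ᵥ v) = μ • v := by
        rw [Matrix.mulVec_smul, Matrix.sub_mulVec, Matrix.one_mulVec, smul_sub, add_smul,
          one_smul] at hv1
        rw [sub_eq_iff_eq_add, add_right_inj] at hv1
        exact hv1.symm
      rw [div_eq_inv_mul, mul_smul, ← h1, smul_smul, inv_mul_cancel₀ hμ1, one_smul]
    have hn := norm_le_specRad hv hTv
    rw [norm_div, div_le_iff₀ (norm_pos_iff.2 hμ1)] at hn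
    rw [← hμ]
    refine hn.trans (mul_le_mul_of_nonneg_left ?_ hT0)
    simpa using norm_add_le 1 μ
  have hge : specRad T ≤ specRad H * (1 - specRad T) := by
    rcases hT0.eq_or_lt with h0 | hpos
    · rw [← h0]; linarith
    obtain ⟨v, hv, hTv⟩ := exists_mulVec_eq_specRad_smul hT hpos
    have hv1 : (1 + H) *ᵥ ((1 - specRad T) • v) = v := by
      rw [sub_smul, one_smul, ← hTv]
      nth_rw 1 [← Matrix.one_mulVec v]
      rw [← Matrix.sub_mulVec, Matrix.mulVec_mulVec, h', Matrix.one_mulVec]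
    have hsub : 0 < 1 - specRad T := sub_pos.2 hlt
    have hHv : H *ᵥ v = (specRad T / (1 - specRad T)) • v := by
      have h1 : (1 - specRad T) • (H *ᵥ v) = specRad T • v := by
        rw [Matrix.mulVec_smul, Matrix.add_mulVec, Matrix.one_mulVec, smul_add] at hv1
        rw [eq_sub_of_add_eq' hv1, sub_smul, one_smul, sub_sub_cancel]
      rw [div_eq_inv_mul, mul_smul, ← h1, smul_smul, inv_mul_cancel₀ hsub.ne', one_smul]
    have := (le_abs_self _).trans (abs_le_specRad hv hHv)
    rwa [div_le_iff₀ hsub] at this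
  rw [eq_div_iff (by positivity)]
  linarith

theorem mul_eq_of_ker_le {m n : ℕ} {A U : Matrix (Fin m) (Fin n) ℝ}
    {G : Matrix (Fin n) (Fin m) ℝ} (hG : A * G * A = A)
    (h : LinearMap.ker A.mulVecLin ≤ LinearMap.ker U.mulVecLin) : U * (G * A) = U := by
  refine Matrix.ext_of_mulVec_single fun j => ?_
  have hmem : (G * A) *ᵥ Pi.single j 1 - Pi.single j 1 ∈ LinearMap.ker A.mulVecLin := by
    rw [LinearMap.mem_ker, Matrix.mulVecLin_apply, Matrix.mulVec_sub, Matrix.mulVec_mulVec,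
      ← Matrix.mul_assoc, hG, sub_self]
  have := h hmem
  rwa [LinearMap.mem_ker, Matrix.mulVecLin_apply, Matrix.mulVec_sub, Matrix.mulVec_mulVec,
    sub_eq_zero] at this

theorem mul_eq_of_range_le {m n : ℕ} {A U : Matrix (Fin m) (Fin n) ℝ}
    {G : Matrix (Fin n) (Fin m) ℝ} (hG : A * G * A = A)
    (h : LinearMap.range U.mulVecLin ≤ LinearMap.range A.mulVecLin) : A * G * U = U := by
  refine Matrix.ext_of_mulVec_single fun j => ?_
  obtain ⟨w, hw⟩ := h ⟨Pi.single j 1, rfl⟩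
  simp only [Matrix.mulVecLin_apply] at hw
  rw [← Matrix.mulVec_mulVec, ← hw, Matrix.mulVec_mulVec, hG]

theorem IsMoorePenrose.mul_eq_mul_of_ker_eq {m n : ℕ} {A U : Matrix (Fin m) (Fin n) ℝ}
    {Ad Ud : Matrix (Fin n) (Fin m) ℝ} (hA : IsMoorePenrose A Ad) (hU : IsMoorePenrose U Ud)
    (h : LinearMap.ker U.mulVecLin = LinearMap.ker A.mulVecLin) : Ud * U = Ad * A := by
  have h1 : Ud * U * (Ad * A) = Ud * U := by
    rw [Matrix.mul_assoc, mul_eq_of_ker_le hA.1 h.ge]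
  have h2 : Ad * A * (Ud * U) = Ad * A := by
    rw [Matrix.mul_assoc, mul_eq_of_ker_le hU.1 h.le]
  calc Ud * U = (Ud * U * (Ad * A))ᵀ := by rw [h1, hU.2.2.2]
    _ = Ad * A := by rw [Matrix.transpose_mul, hA.2.2.2, hU.2.2.2, h2]

theorem IsProperSplitting.one_sub_mul_one_add {m n : ℕ} {A U V : Matrix (Fin m) (Fin n) ℝ}
    {Ad Ud : Matrix (Fin n) (Fin m) ℝ} (hPS : IsProperSplitting A U V)
    (hA : IsMoorePenrose A Ad) (hU : IsMoorePenrose U Ud) :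
    (1 - Ud * V) * (1 + Ad * V) = 1 := by
  obtain ⟨hV, hrange, hker⟩ := hPS
  obtain rfl : V = U - A := by rw [hV, sub_sub_cancel]
  have hP : Ud * U = Ad * A := hA.mul_eq_mul_of_ker_eq hU hker
  have hAU : A * (Ad * U) = U := by rw [← Matrix.mul_assoc, mul_eq_of_range_le hA.1 hrange.le]
  have h1 : Ud * U * (Ad * U) = Ad * U := by rw [hP, Matrix.mul_assoc, hAU]
  have h2 : Ud * A * (Ad * U) = Ud * U := by rw [Matrix.mul_assoc, hAU]
  have h3 : Ud * U * (Ad * A) = Ud * U := by rw [← hP, ← Matrix.mul_assoc, hU.2.1]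
  have h4 : Ud * A * (Ad * A) = Ud * A := by rw [Matrix.mul_assoc, ← Matrix.mul_assoc A, hA.1]
  simp only [Matrix.mul_sub, mul_sub, sub_mul, mul_add, one_mul, mul_one, h1, h2, h3, h4]
  rw [hP]
  abel

theorem stmt10 {m n : ℕ} (A U V : Matrix (Fin m) (Fin n) ℝ)
    (Ad Ud : Matrix (Fin n) (Fin m) ℝ)
    (hA : IsMoorePenrose A Ad) (hU : IsMoorePenrose U Ud)
    (hPS : IsProperSplitting A U V)
    (hUd : ∀ i j, 0 ≤ Ud i j) (hUV : ∀ i j, 0 ≤ (Ud * V) i j)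
    (hge : ∀ i j, (Ud * V) i j ≤ (Ad * V) i j) :
    specRad (Ud * V) = specRad (Ad * V) / (1 + specRad (Ad * V)) ∧
      specRad (Ud * V) < 1 :=
  specRad_eq_div_one_add hUV (fun i j => (hUV i j).trans (hge i j))
    (hPS.one_sub_mul_one_add hA hU)
end
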